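/- For every β ∈ (0,∞) and h ∈ ℝ, the Schonmann projection ν_{β,h}^+ is a g-measure consistent with the g-function P_{β,h}^{+,+}; equivalently, ν_{β,h}^+ = ν_{β,h}^{+,+}. -/

import Mathlib

open MeasureTheory Filter Topology ProbabilityTheory

noncomputable section

/-- Spin value of a Boolean spin: `true ↦ +1`, `false ↦ -1`. -/
def sval (b : Bool) : ℝ := if b then 1 else -1

/-- Two-dimensional spin configurations. -/
abbrev Cfg2 := ℤ × ℤ → Bool

/-- Two-sided sequences over an alphabet `A`. -/
abbrev ZSeq (A : Type*) := ℤ → A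

/-- Pasts: index `k` corresponds to the coordinate `-(k+1)`. -/
abbrev Past (A : Type*) := ℕ → A

/-- The four nearest neighbours of a site of `ℤ²`. -/
def nbrs (x : ℤ × ℤ) : Finset (ℤ × ℤ) :=
  {(x.1 + 1, x.2), (x.1 - 1, x.2), (x.1, x.2 + 1), (x.1, x.2 - 1)}

/-- Boltzmann weight
`exp(β[Σ_{{x,y}⊆Λ, x∼y} ω_x ω_y + Σ_{x∈Λ, y∉Λ, x∼y} ω_x σ_y] − h Σ_{x∈Λ} ω_x)`
(the sum over unordered pairs inside `Λ` is written as half the ordered sum). -/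
def isingWeight (β h : ℝ) (Λ : Finset (ℤ × ℤ)) (σ ω : Cfg2) : ℝ :=
  Real.exp (β * ((∑ x ∈ Λ, ∑ y ∈ Λ.filter (fun y => y ∈ nbrs x),
        sval (ω x) * sval (ω y)) / 2
      + ∑ x ∈ Λ, ∑ y ∈ (nbrs x).filter (fun y => y ∉ Λ), sval (ω x) * sval (σ y))
    - h * ∑ x ∈ Λ, sval (ω x))

/-- Fill in the values `τ` inside `Λ` and `σ` outside. -/
def fill (Λ : Finset (ℤ × ℤ)) (σ : Cfg2) (τ : ↥Λ → Bool) : Cfg2 :=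
  fun x => if hx : x ∈ Λ then τ ⟨x, hx⟩ else σ x

/-- The finite-volume Ising measure in `Λ` with boundary condition `σ`, viewed as a measure on
the full configuration space, the spins outside `Λ` being frozen to `σ`. -/
def isingFV (β h : ℝ) (Λ : Finset (ℤ × ℤ)) (σ : Cfg2) : Measure Cfg2 :=
  (∑ τ : ↥Λ → Bool, ENNReal.ofReal (isingWeight β h Λ σ (fill Λ σ τ)))⁻¹ •
    ∑ τ : ↥Λ → Bool,
      ENNReal.ofReal (isingWeight β h Λ σ (fill Λ σ τ)) • Measure.dirac (fill Λ σ τ)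

/-- The box `[-n,n]²`. -/
def box (n : ℕ) : Finset (ℤ × ℤ) :=
  (Finset.Icc (-(n : ℤ)) (n : ℤ)) ×ˢ (Finset.Icc (-(n : ℤ)) (n : ℤ))

/-- Convergence of a sequence of measures on a product space in the sense of convergence of the
measures of all finite-dimensional cylinder events; for probability measures on `{−1,+1}^ι`
this is exactly weak convergence. -/
def CylTendsto {ι A : Type*} [MeasurableSpace A] (μs : ℕ → Measure (ι → A))
    (μ : Measure (ι → A)) : Prop :=
  ∀ (s : Finset ι) (f : ι → A),
    Tendsto (fun n => μs n {η | ∀ i ∈ s, η i = f i}) atTop (𝓝 (μ {η | ∀ i ∈ s, η i = f i}))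

/-- `μ` is the plus phase `μ_{β,h}^+`: the weak limit of the finite-volume Ising measures on
`[-n,n]²` with all-plus boundary conditions. -/
def IsPlusPhase (β h : ℝ) (μ : Measure Cfg2) : Prop :=
  IsProbabilityMeasure μ ∧ CylTendsto (fun n => isingFV β h (box n) (fun _ => true)) μ

/-- `μ` is the minus phase `μ_{β,h}^-`. -/
def IsMinusPhase (β h : ℝ) (μ : Measure Cfg2) : Prop :=
  IsProbabilityMeasure μ ∧ CylTendsto (fun n => isingFV β h (box n) (fun _ => false)) μ

/-- The critical inverse temperature `β_c = ln(1+√2)/2`. -/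
def betaCrit : ℝ := Real.log (1 + Real.sqrt 2) / 2

/-- Projection of a two-dimensional configuration onto the line `ℤ × {0}`. -/
def lineProj (η : Cfg2) : ZSeq Bool := fun i => η (i, 0)

/-- The Schonmann projection of a measure on `{−1,+1}^{ℤ²}`. -/
def schonmann (μ : Measure Cfg2) : Measure (ZSeq Bool) := μ.map lineProj

/-- Restriction of a two-sided sequence to its strict past; index `k` is coordinate `-(k+1)`. -/
def restrictPast {A : Type*} (ω : ZSeq A) : Past A := fun k => ω (-(k + 1 : ℤ))

/-- The shift on two-sided sequences. -/
def shiftSeq {A : Type*} : ZSeq A → ZSeq A := fun ω i => ω (i + 1)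

/-- The σ-algebra `ℱ_{<0}` generated by the coordinates of negative index. -/
def pastSigma (A : Type*) [MeasurableSpace A] : MeasurableSpace (ZSeq A) :=
  MeasurableSpace.comap (fun ω : ZSeq A => restrictPast ω) inferInstance

/-- The σ-algebra generated by the coordinates in `S`. -/
def sigmaOn {ι A : Type*} [MeasurableSpace A] (S : Set ι) : MeasurableSpace (ι → A) :=
  MeasurableSpace.comap (fun ω : ι → A => S.restrict ω) inferInstance

/-- A g-function on the alphabet `A`: measurable, `[0,1]`-valued, normalized. -/
def IsGFunction {A : Type*} [Fintype A] [MeasurableSpace A] (P : A → Past A → ℝ) : Prop :=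
  (∀ a, Measurable (P a)) ∧ ∀ ω, (∑ a : A, P a ω) = 1 ∧ ∀ a, P a ω ∈ Set.Icc (0 : ℝ) 1

/-- `μ` is a translation-invariant g-measure consistent with the g-function `P`: for each `a`,
`ω ↦ P a (restrictPast ω)` is a version of the conditional probability `μ(X₀ = a | ℱ_{<0})`. -/
def IsGMeasure {A : Type*} [MeasurableSpace A] (μ : Measure (ZSeq A))
    (P : A → Past A → ℝ) : Prop :=
  IsProbabilityMeasure μ ∧ μ.map shiftSeq = μ ∧
    ∀ a : A, (fun ω => P a (restrictPast ω))
      =ᵐ[μ] μ[Set.indicator {ω : ZSeq A | ω 0 = a} (fun _ => (1 : ℝ)) | pastSigma A]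

/-- The `k`-th variation of a g-function: the supremum of `|P a ω − P a σ|` over pasts agreeing
on the coordinates `−k,…,−1`. -/
def varG {A : Type*} (P : A → Past A → ℝ) (k : ℕ) : ℝ :=
  sSup {d : ℝ | ∃ (a : A) (ω σ' : Past A), (∀ j < k, ω j = σ' j) ∧ d = |P a ω - P a σ'|}

/-- Elementary conditional probability `μ(B | A)`, as a real number. -/
def condProbR {X : Type*} [MeasurableSpace X] (μ : Measure X) (B A : Set X) : ℝ :=
  ((μ[|A]) B).toReal

/-- The event that `η_i = ω` (suitably reindexed) for `−n ≤ i ≤ −1` and `η_i = b`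
for `−(n+l) ≤ i ≤ −(n+1)`. -/
def pastEvt (n l : ℕ) (b : Bool) (ω : Past Bool) : Set (ZSeq Bool) :=
  {η | (∀ i : ℤ, -(n : ℤ) ≤ i → i ≤ -1 → η i = ω (i.natAbs - 1)) ∧
       (∀ i : ℤ, -((n : ℤ) + l) ≤ i → i ≤ -((n : ℤ) + 1) → η i = b)}

/-- The event that `η_i = b` for `−(n+l) ≤ i ≤ −n`. -/
def blockEvt (n l : ℕ) (b : Bool) : Set (ZSeq Bool) :=
  {η | ∀ i : ℤ, -((n : ℤ) + l) ≤ i → i ≤ -(n : ℤ) → η i = b}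

/-- The event that `η_i = b` for `−n ≤ i ≤ −1`. -/
def allBlock (n : ℕ) (b : Bool) : Set (ZSeq Bool) :=
  {η | ∀ i : ℤ, -(n : ℤ) ≤ i → i ≤ -1 → η i = b}

/-- `P` is the g-function `P^{+,b}` obtained from `ν` by conditioning on the symbol `b`
in the far past: `P(a|ω) = lim_n lim_l ν(η₀ = a | η = b on [−(n+l),−(n+1)], η = ω on [−n,−1])`,
both iterated limits being required to exist. -/
def IsCondG (ν : Measure (ZSeq Bool)) (b : Bool) (P : Bool → Past Bool → ℝ) : Prop :=
  ∀ (a : Bool) (ω : Past Bool), ∃ L : ℕ → ℝ,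
    (∀ n, Tendsto (fun l => condProbR ν {η | η 0 = a} (pastEvt n l b ω)) atTop (𝓝 (L n))) ∧
    Tendsto L atTop (𝓝 (P a ω))

/-- `ν'` is the iterated weak limit `lim_n lim_l ν( · | η = b on [−(n+l),−n])`. -/
def IsCondLimitMeasure (ν : Measure (ZSeq Bool)) (b : Bool) (ν' : Measure (ZSeq Bool)) : Prop :=
  ∃ νseq : ℕ → Measure (ZSeq Bool),
    (∀ n, CylTendsto (fun l => ν[|blockEvt n l b]) (νseq n)) ∧ CylTendsto νseq ν'

/-- Stochastic domination: `ν ≤ μ` iff `ν B ≤ μ B` for every increasing measurable event `B`. -/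
def StochDom {A : Type*} [MeasurableSpace A] [Preorder A]
    (ν μ : Measure (ZSeq A)) : Prop :=
  ∀ B : Set (ZSeq A), MeasurableSet B → (∀ ⦃x y : ZSeq A⦄, x ≤ y → x ∈ B → y ∈ B) → ν B ≤ μ B

/-- `π` is the i.i.d. product measure with `π(η_i = +1) = ρ` for each coordinate. -/
def IsBernoulliProd (ρ : ℝ) (π : Measure (ZSeq Bool)) : Prop :=
  IsProbabilityMeasure π ∧ ∀ (s : Finset ℤ) (f : ℤ → Bool),
    π {η | ∀ i ∈ s, η i = f i} = ∏ i ∈ s, ENNReal.ofReal (if f i then ρ else 1 - ρ)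

/-- Splicing of pasts: coordinates `−k,…,−1` (indices `< k`) from `ω`, the rest from `σ`. -/
def splice {A : Type*} (σ ω : Past A) (k : ℕ) : Past A := fun j => if j < k then ω j else σ j

/-- `ν'` is an extreme point of the convex set of g-measures consistent with `P`. -/
def ExtremeGMeasure (ν' : Measure (ZSeq Bool)) (P : Bool → Past Bool → ℝ) : Prop :=
  IsGMeasure ν' P ∧
  ∀ ν₁ ν₂ : Measure (ZSeq Bool), IsGMeasure ν₁ P → IsGMeasure ν₂ P →
    ∀ t : ℝ, t ∈ Set.Ioo (0 : ℝ) 1 →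
      ν' = ENNReal.ofReal t • ν₁ + ENNReal.ofReal (1 - t) • ν₂ → ν₁ = ν' ∧ ν₂ = ν'

/-- The event that the spins on the line are `−1` on `{−m,…,−n} × {0}`. -/
def lineMinusEvt (n m : ℕ) : Set Cfg2 :=
  {η | ∀ i : ℤ, -(m : ℤ) ≤ i → i ≤ -(n : ℤ) → η (i, 0) = false}

/-- Nearest-neighbour adjacency in `ℤ²` (`‖x−y‖₁ = 1`). -/
def adj2 (x y : ℤ × ℤ) : Prop := (x.1 - y.1).natAbs + (x.2 - y.2).natAbs = 1

/-- The event `A_n`: there is an infinite nearest-neighbour path of `+1` spins starting at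
`(n,0)` entirely contained in the half-plane `{x ≤ n}`. -/
def plusPathEvt (n : ℕ) : Set Cfg2 :=
  {η | ∃ γ : ℕ → ℤ × ℤ, γ 0 = ((n : ℤ), 0) ∧ (∀ j, adj2 (γ j) (γ (j + 1))) ∧
    Function.Injective γ ∧ (∀ j, (γ j).1 ≤ (n : ℤ)) ∧ ∀ j, η (γ j) = true}

/-- The block map for the decimation `ν_{l,k}`: the `j`-th letter consists of the spins on
`[j(k+l), j(k+l)+l−1]`. -/
def blockMap (l k : ℕ) (η : ZSeq Bool) : ZSeq (Fin l → Bool) :=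
  fun j r => η (j * ((k : ℤ) + l) + r)

end

/-- Ordered pairs of neighbouring sites inside `D`. -/
def bonds (D : Finset (ℤ × ℤ)) : Finset ((ℤ × ℤ) × (ℤ × ℤ)) :=
  (D ×ˢ D).filter (fun p => p.2 ∈ nbrs p.1)

/-- The Boltzmann weight, up to a constant depending on the volume, of the configuration whose
set of minus spins is `D`, with plus boundary condition. -/
noncomputable def minusWeight (β h : ℝ) (D : Finset (ℤ × ℤ)) : ℝ :=
  Real.exp (2 * β * (bonds D).card - (8 * β - 2 * h) * D.card)

/-- The configuration whose set of minus spins is `D`. -/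
def minusCfg (D : Finset (ℤ × ℤ)) : Cfg2 := fun x => decide (x ∉ D)

open Classical in
/-- Unnormalized finite-volume weight of an event with plus boundary condition. -/
noncomputable def plusMass (β h : ℝ) (Λ : Finset (ℤ × ℤ)) (E : Set Cfg2) : ℝ :=
  ∑ D ∈ Λ.powerset.filter (fun D => minusCfg D ∈ E), minusWeight β h D

/-- Finite-volume probability of an event with plus boundary condition. -/
noncomputable def plusProb (β h : ℝ) (Λ : Finset (ℤ × ℤ)) (E : Set Cfg2) : ℝ :=
  plusMass β h Λ E / plusMass β h Λ Set.univ

theorem mem_nbrs_comm {x y : ℤ × ℤ} : y ∈ nbrs x ↔ x ∈ nbrs y := by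
  rcases x with ⟨a, b⟩
  rcases y with ⟨c, d⟩
  simp only [nbrs, Finset.mem_insert, Finset.mem_singleton, Prod.mk.injEq]
  omega

theorem card_nbrs (x : ℤ × ℤ) : (nbrs x).card = 4 := by
  rcases x with ⟨a, b⟩
  simp only [nbrs]
  rw [Finset.card_insert_of_notMem, Finset.card_insert_of_notMem, Finset.card_insert_of_notMem,
    Finset.card_singleton]
  all_goals
    simp only [Finset.mem_insert, Finset.mem_singleton, Prod.mk.injEq]
    omega

theorem minusWeight_pos (β h : ℝ) (D : Finset (ℤ × ℤ)) : 0 < minusWeight β h D :=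
  Real.exp_pos _

theorem minusWeight_mul_le {β : ℝ} (hβ : 0 < β) (h : ℝ) (D D' : Finset (ℤ × ℤ)) :
    minusWeight β h D * minusWeight β h D' ≤
      minusWeight β h (D ∩ D') * minusWeight β h (D ∪ D') := by
  have hc : ((D ∪ D').card : ℝ) + (D ∩ D').card = D.card + D'.card := by
    exact_mod_cast Finset.card_union_add_card_inter D D'
  have hb : ((bonds D).card : ℝ) + (bonds D').card ≤
      (bonds (D ∩ D')).card + (bonds (D ∪ D')).card := by
    have h1 : bonds D ∩ bonds D' ⊆ bonds (D ∩ D') := by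
      intro p hp
      simp only [bonds, Finset.mem_inter, Finset.mem_filter, Finset.mem_product] at hp ⊢
      tauto
    have h2 : bonds D ∪ bonds D' ⊆ bonds (D ∪ D') := by
      intro p hp
      simp only [bonds, Finset.mem_union, Finset.mem_filter, Finset.mem_product] at hp ⊢
      tauto
    have h3 := Finset.card_union_add_card_inter (bonds D) (bonds D')
    have h4 := Finset.card_le_card h1
    have h5 := Finset.card_le_card h2
    exact_mod_cast (by omega : (bonds D).card + (bonds D').card ≤
      (bonds (D ∩ D')).card + (bonds (D ∪ D')).card)
  simp only [minusWeight, ← Real.exp_add]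
  apply Real.exp_le_exp.mpr
  have h6 := mul_le_mul_of_nonneg_left hb (by positivity : 0 ≤ 2 * β)
  have h7 : (8 * β - 2 * h) * (((D ∪ D').card : ℝ) + (D ∩ D').card) =
    (8 * β - 2 * h) * (D.card + D'.card) := by rw [hc]
  linarith

/-- The four functions theorem for events of the finite-volume plus measures. -/
theorem plusMass_mul_le {β : ℝ} (hβ : 0 < β) (h : ℝ) {Λ₁ Λ₂ : Finset (ℤ × ℤ)}
    {E F G H : Set Cfg2}
    (hEF : ∀ D ⊆ Λ₁, ∀ D' ⊆ Λ₂, minusCfg D ∈ E → minusCfg D' ∈ F →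
      minusCfg (D ∪ D') ∈ G ∧ minusCfg (D ∩ D') ∈ H) :
    plusMass β h Λ₁ E * plusMass β h Λ₂ F ≤
      plusMass β h (Λ₁ ∪ Λ₂) G * plusMass β h (Λ₁ ∩ Λ₂) H := by
  classical
  have hnn : (0 : Finset (ℤ × ℤ) → ℝ) ≤ minusWeight β h := fun D => (minusWeight_pos β h D).le
  have := four_functions_theorem (minusWeight β h) (minusWeight β h) (minusWeight β h)
    (minusWeight β h) hnn hnn hnn hnn (minusWeight_mul_le hβ h)
    (Λ₁.powerset.filter (fun D => minusCfg D ∈ E)) (Λ₂.powerset.filter (fun D => minusCfg D ∈ F))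
  unfold plusMass
  refine this.trans ?_
  rw [mul_comm]
  refine mul_le_mul ?_ ?_ (Finset.sum_nonneg fun D _ => hnn D) (Finset.sum_nonneg fun D _ => hnn D)
  · refine Finset.sum_le_sum_of_subset_of_nonneg ?_ fun D _ _ => hnn D
    intro D hD
    obtain ⟨a, ha, b, hb, rfl⟩ := Finset.mem_sups.mp hD
    simp only [Finset.mem_filter, Finset.mem_powerset] at ha hb ⊢
    exact ⟨Finset.union_subset_union ha.1 hb.1, (hEF a ha.1 b hb.1 ha.2 hb.2).1⟩
  · refine Finset.sum_le_sum_of_subset_of_nonneg ?_ fun D _ _ => hnn D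
    intro D hD
    obtain ⟨a, ha, b, hb, rfl⟩ := Finset.mem_infs.mp hD
    simp only [Finset.mem_filter, Finset.mem_powerset] at ha hb ⊢
    exact ⟨Finset.inter_subset_inter ha.1 hb.1, (hEF a ha.1 b hb.1 ha.2 hb.2).2⟩

theorem plusMass_univ_pos (β h : ℝ) (Λ : Finset (ℤ × ℤ)) : 0 < plusMass β h Λ Set.univ :=
  Finset.sum_pos (fun D _ => minusWeight_pos β h D) ⟨∅, by simp⟩

theorem minusCfg_union (D D' : Finset (ℤ × ℤ)) :
    minusCfg (D ∪ D') = minusCfg D ⊓ minusCfg D' := by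
  funext x
  simp [minusCfg]

theorem minusCfg_inter (D D' : Finset (ℤ × ℤ)) :
    minusCfg (D ∩ D') = minusCfg D ⊔ minusCfg D' := by
  funext x
  by_cases h1 : x ∈ D <;> by_cases h2 : x ∈ D' <;> simp [minusCfg, h1, h2]

/-- Ahlswede–Daykin inequality for events of a finite-volume plus measure. -/
theorem plusProb_mul_le {β : ℝ} (hβ : 0 < β) (h : ℝ) (Λ : Finset (ℤ × ℤ)) {E F G H : Set Cfg2}
    (hEF : ∀ a ∈ E, ∀ b ∈ F, a ⊓ b ∈ G ∧ a ⊔ b ∈ H) :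
    plusProb β h Λ E * plusProb β h Λ F ≤ plusProb β h Λ G * plusProb β h Λ H := by
  have := plusMass_mul_le hβ h (Λ₁ := Λ) (Λ₂ := Λ) (E := E) (F := F) (G := G) (H := H)
    (fun D _ D' _ ha hb => by rw [minusCfg_union, minusCfg_inter]; exact hEF _ ha _ hb)
  rw [Finset.union_idempotent, Finset.inter_self] at this
  simp only [plusProb, div_mul_div_comm]
  exact div_le_div_of_nonneg_right this (mul_self_nonneg _)

/-- Conditioning on an event that is insensitive to spins of a smaller box is dominated by the
plus measure of that box. -/
theorem plusProb_inter_le {β : ℝ} (hβ : 0 < β) (h : ℝ) {Λ Λ' : Finset (ℤ × ℤ)} (hΛ : Λ ⊆ Λ')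
    {A B : Set Cfg2} (hA : IsUpperSet A)
    (hB : ∀ a ∈ B, ∀ b : Cfg2, (∀ x ∉ Λ, b x = true) → a ⊓ b ∈ B) :
    plusProb β h Λ' (A ∩ B) ≤ plusProb β h Λ' B * plusProb β h Λ A := by
  have := plusMass_mul_le hβ h (Λ₁ := Λ') (Λ₂ := Λ) (E := A ∩ B) (F := Set.univ) (G := B) (H := A)
    (fun D _ D' hD' ha _ => by
      rw [minusCfg_union, minusCfg_inter]
      refine ⟨hB _ ha.2 _ fun x hx => ?_, hA le_sup_left ha.1⟩
      simpa [minusCfg] using fun hx' => hx (hD' hx'))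
  rw [Finset.union_eq_left.mpr hΛ, Finset.inter_eq_right.mpr hΛ] at this
  simp only [plusProb, div_mul_div_comm]
  have h1 := plusMass_univ_pos β h Λ
  have h2 := plusMass_univ_pos β h Λ'
  rw [div_le_div_iff₀ h2 (mul_pos h2 h1)]
  nlinarith

theorem plusProb_univ (β h : ℝ) (Λ : Finset (ℤ × ℤ)) : plusProb β h Λ Set.univ = 1 :=
  div_self (plusMass_univ_pos β h Λ).ne'

theorem plusProb_anti {β : ℝ} (hβ : 0 < β) (h : ℝ) {Λ Λ' : Finset (ℤ × ℤ)} (hΛ : Λ ⊆ Λ')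
    {A : Set Cfg2} (hA : IsUpperSet A) : plusProb β h Λ' A ≤ plusProb β h Λ A := by
  have := plusProb_inter_le hβ h hΛ hA (B := Set.univ) (by simp)
  rwa [Set.inter_univ, plusProb_univ, one_mul] at this

theorem plusProb_nonneg (β h : ℝ) (Λ : Finset (ℤ × ℤ)) (A : Set Cfg2) : 0 ≤ plusProb β h Λ A :=
  div_nonneg (Finset.sum_nonneg fun D _ => (minusWeight_pos β h D).le) (plusMass_univ_pos β h Λ).le

/-- Translation of sites by one unit along the line. -/
def siteShift : (ℤ × ℤ) ↪ (ℤ × ℤ) :=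
  ⟨fun x => (x.1 + 1, x.2), fun x y hxy => by
    rcases x with ⟨a, b⟩
    rcases y with ⟨c, d⟩
    simp only [Prod.mk.injEq, add_left_inj] at hxy ⊢
    exact hxy⟩

theorem siteShift_apply (x : ℤ × ℤ) : siteShift x = (x.1 + 1, x.2) := rfl

theorem siteShift_mem_nbrs {x y : ℤ × ℤ} : siteShift y ∈ nbrs (siteShift x) ↔ y ∈ nbrs x := by
  rcases x with ⟨a, b⟩
  rcases y with ⟨c, d⟩
  simp only [siteShift_apply, nbrs, Finset.mem_insert,
    Finset.mem_singleton, Prod.mk.injEq]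
  omega

theorem minusWeight_map_siteShift (β h : ℝ) (D : Finset (ℤ × ℤ)) :
    minusWeight β h (D.map siteShift) = minusWeight β h D := by
  have : bonds (D.map siteShift) = (bonds D).map (siteShift.prodMap siteShift) := by
    ext ⟨x, y⟩
    simp only [bonds, Finset.mem_filter, Finset.mem_product, Finset.mem_map, Prod.exists,
      Function.Embedding.coe_prodMap, Prod.map_apply, Prod.mk.injEq]
    constructor
    · rintro ⟨⟨⟨a, b, ha, rfl⟩, ⟨c, d, hc, rfl⟩⟩, hxy⟩
      exact ⟨a, b, c, d, ⟨⟨ha, hc⟩, siteShift_mem_nbrs.mp hxy⟩, rfl, rfl⟩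
    · rintro ⟨a, b, c, d, ⟨⟨ha, hc⟩, hxy⟩, rfl, rfl⟩
      exact ⟨⟨⟨a, b, ha, rfl⟩, ⟨c, d, hc, rfl⟩⟩, siteShift_mem_nbrs.mpr hxy⟩
  simp only [minusWeight, this, Finset.card_map]

theorem plusMass_map_siteShift (β h : ℝ) (Λ : Finset (ℤ × ℤ)) (E : Set Cfg2) :
    plusMass β h (Λ.map siteShift) E = plusMass β h Λ {η | (fun x => η (x.1 - 1, x.2)) ∈ E} := by
  classical
  have hcfg : ∀ D : Finset (ℤ × ℤ),
      minusCfg (D.map siteShift) = fun x => minusCfg D (x.1 - 1, x.2) := by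
    intro D
    funext x
    simp only [minusCfg, decide_eq_decide, Finset.mem_map, not_iff_not]
    constructor
    · rintro ⟨y, hy, rfl⟩
      simpa [siteShift_apply] using hy
    · exact fun hx => ⟨_, hx, by simp [siteShift_apply]⟩
  unfold plusMass
  symm
  refine Finset.sum_bij (fun D _ => D.map siteShift) ?_ ?_ ?_ ?_
  · intro D hD
    simp only [Finset.mem_filter, Finset.mem_powerset, Set.mem_ofPred_eq] at hD ⊢
    exact ⟨Finset.map_subset_map.mpr hD.1, by rw [hcfg]; exact hD.2⟩
  · intro D _ D' _ hDD
    exact Finset.map_injective _ hDD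
  · intro D hD
    simp only [Finset.mem_filter, Finset.mem_powerset] at hD
    obtain ⟨D', hD', rfl⟩ := Finset.subset_map_iff.mp hD.1
    refine ⟨D', ?_, rfl⟩
    simp only [Finset.mem_filter, Finset.mem_powerset, Set.mem_ofPred_eq]
    exact ⟨hD', by rw [← hcfg]; exact hD.2⟩
  · intro D _
    exact (minusWeight_map_siteShift β h D).symm

theorem plusProb_map_siteShift (β h : ℝ) (Λ : Finset (ℤ × ℤ)) (E : Set Cfg2) :
    plusProb β h (Λ.map siteShift) E = plusProb β h Λ {η | (fun x => η (x.1 - 1, x.2)) ∈ E} := by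
  simp only [plusProb, plusMass_map_siteShift]
  simp

theorem card_bonds_insert_le (x : ℤ × ℤ) (D : Finset (ℤ × ℤ)) :
    (bonds (insert x D)).card ≤ (bonds D).card + 8 := by
  have hsub : bonds (insert x D) ⊆
      bonds D ∪ ((nbrs x).image (fun y => (x, y)) ∪ (nbrs x).image (fun y => (y, x))) := by
    rintro ⟨a, b⟩ hp
    simp only [bonds, Finset.mem_union, Finset.mem_filter, Finset.mem_product, Finset.mem_insert,
      Finset.mem_image, Prod.mk.injEq] at hp ⊢
    obtain ⟨⟨ha | ha, hb⟩, hab⟩ := hp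
    · subst ha
      exact Or.inr (Or.inl ⟨b, hab, rfl, rfl⟩)
    · rcases hb with hb | hb
      · subst hb
        exact Or.inr (Or.inr ⟨a, mem_nbrs_comm.mp hab, rfl, rfl⟩)
      · exact Or.inl ⟨⟨ha, hb⟩, hab⟩
  have h1 := Finset.card_le_card hsub
  have h2 := Finset.card_union_le (bonds D)
    ((nbrs x).image (fun y => (x, y)) ∪ (nbrs x).image (fun y => (y, x)))
  have h3 := Finset.card_union_le ((nbrs x).image (fun y => (x, y)))
    ((nbrs x).image (fun y => (y, x)))
  have h4 := Finset.card_image_le (s := nbrs x) (f := fun y => (x, y))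
  have h5 := Finset.card_image_le (s := nbrs x) (f := fun y => (y, x))
  rw [card_nbrs] at h4 h5
  omega

theorem minusWeight_insert_bounds {β : ℝ} (hβ : 0 < β) (h : ℝ) {x : ℤ × ℤ}
    {D : Finset (ℤ × ℤ)} (hx : x ∉ D) :
    minusWeight β h (insert x D) ≤ Real.exp (16 * β + |8 * β - 2 * h|) * minusWeight β h D ∧
      minusWeight β h D ≤ Real.exp (16 * β + |8 * β - 2 * h|) * minusWeight β h (insert x D) := by
  have h1 : ((bonds (insert x D)).card : ℝ) ≤ (bonds D).card + 8 := by
    exact_mod_cast card_bonds_insert_le x D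
  have h2 : ((bonds D).card : ℝ) ≤ (bonds (insert x D)).card := by
    refine Nat.cast_le.mpr (Finset.card_le_card ?_)
    intro p hp
    simp only [bonds, Finset.mem_filter, Finset.mem_product, Finset.mem_insert] at hp ⊢
    tauto
  have h3 := mul_le_mul_of_nonneg_left h1 (by positivity : 0 ≤ 2 * β)
  have h4 := mul_le_mul_of_nonneg_left h2 (by positivity : 0 ≤ 2 * β)
  have h5 := le_abs_self (8 * β - 2 * h)
  have h6 := neg_abs_le (8 * β - 2 * h)
  simp only [minusWeight, ← Real.exp_add, Finset.card_insert_of_notMem hx, Nat.cast_add,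
    Nat.cast_one]
  constructor <;> apply Real.exp_le_exp.mpr <;> nlinarith

/-- Finite energy: forcing the spin at one site costs at most a constant factor. -/
theorem plusMass_le_mul_inter {β : ℝ} (hβ : 0 < β) (h : ℝ) {Λ : Finset (ℤ × ℤ)} {x : ℤ × ℤ}
    (hx : x ∈ Λ) (a : Bool) {E : Set Cfg2}
    (hE : ∀ η η' : Cfg2, (∀ y ≠ x, η y = η' y) → (η ∈ E ↔ η' ∈ E)) :
    plusMass β h Λ E ≤ (1 + Real.exp (16 * β + |8 * β - 2 * h|)) *
      plusMass β h Λ (E ∩ {η | η x = a}) := by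
  classical
  obtain ⟨Λ, hxΛ, rfl⟩ : ∃ Λ', x ∉ Λ' ∧ insert x Λ' = Λ :=
    ⟨Λ.erase x, Finset.notMem_erase x Λ, Finset.insert_erase hx⟩
  simp only [plusMass, Finset.sum_filter]
  rw [Finset.sum_powerset_insert hxΛ, Finset.sum_powerset_insert hxΛ, ← Finset.sum_add_distrib,
    ← Finset.sum_add_distrib, Finset.mul_sum]
  refine Finset.sum_le_sum fun D hD => ?_
  have hxD : x ∉ D := fun hxD => hxΛ (Finset.mem_powerset.mp hD hxD)
  have hins : minusCfg (insert x D) ∈ E ↔ minusCfg D ∈ E := by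
    refine hE _ _ fun y hy => ?_
    simp [minusCfg, hy]
  have h1 : minusCfg D x = true := by simp [minusCfg, hxD]
  have h2 : minusCfg (insert x D) x = false := by simp [minusCfg]
  obtain ⟨h3, h4⟩ := minusWeight_insert_bounds hβ h hxD
  simp only [Set.mem_inter_iff, hins, Set.mem_ofPred_eq, h1, h2]
  by_cases hDE : minusCfg D ∈ E
  · cases a <;> simp [hDE] <;> linarith
  · simp [hDE]

theorem plusProb_cylinder_ge {β : ℝ} (hβ : 0 < β) (h : ℝ) {Λ : Finset (ℤ × ℤ)}
    (f : Cfg2) (S : Finset (ℤ × ℤ)) (hS : S ⊆ Λ) :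
    ((1 + Real.exp (16 * β + |8 * β - 2 * h|))⁻¹) ^ S.card ≤
      plusProb β h Λ {η | ∀ i ∈ S, η i = f i} := by
  classical
  induction S using Finset.induction with
  | empty => simp [plusProb_univ]
  | insert x S hxS ih =>
    have hx : x ∈ Λ := hS (Finset.mem_insert_self x S)
    have hK : 0 < 1 + Real.exp (16 * β + |8 * β - 2 * h|) := by positivity
    have h1 := ih fun y hy => hS (Finset.mem_insert_of_mem hy)
    have h2 := plusMass_le_mul_inter hβ h hx (f x) (E := {η | ∀ i ∈ S, η i = f i})
      (fun η η' hη => by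
        refine forall₂_congr fun i hi => ?_
        rw [hη i fun hix => hxS (hix ▸ hi)])
    have h3 : {η : Cfg2 | ∀ i ∈ S, η i = f i} ∩ {η | η x = f x} =
        {η | ∀ i ∈ insert x S, η i = f i} := by
      ext η
      simp only [Set.mem_inter_iff, Set.mem_ofPred_eq, Finset.forall_mem_insert]
      exact and_comm
    rw [h3] at h2
    rw [Finset.card_insert_of_notMem hxS, pow_succ, mul_comm, inv_mul_le_iff₀ hK]
    refine h1.trans ?_
    simp only [plusProb]
    rw [← mul_div_assoc]
    exact div_le_div_of_nonneg_right h2 (plusMass_univ_pos β h Λ).le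

theorem sum_fill_plus {M : Type*} [AddCommMonoid M] (Λ : Finset (ℤ × ℤ)) (F : Cfg2 → M) :
    ∑ τ : ↥Λ → Bool, F (fill Λ (fun _ => true) τ) = ∑ D ∈ Λ.powerset, F (minusCfg D) := by
  have hfill : ∀ τ : ↥Λ → Bool,
      minusCfg (Λ.filter fun x => fill Λ (fun _ => true) τ x = false) =
        fill Λ (fun _ => true) τ := by
    intro τ
    funext x
    by_cases hx : x ∈ Λ <;> simp [minusCfg, fill, hx]
  refine Finset.sum_bij' (fun τ _ => Λ.filter fun x => fill Λ (fun _ => true) τ x = false)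
    (fun D _ x => minusCfg D x) ?_ ?_ ?_ ?_ ?_
  · intro τ _
    exact Finset.mem_powerset.mpr (Finset.filter_subset _ _)
  · intro D _
    exact Finset.mem_univ _
  · intro τ _
    funext x
    rw [hfill]
    simp [fill]
  · intro D hD
    ext x
    have := Finset.mem_powerset.mp hD
    by_cases hx : x ∈ Λ
    · simp [fill, hx, minusCfg]
    · simpa [hx] using fun hx' => hx (this hx')
  · intro τ _
    rw [hfill]

theorem isingWeight_plus_eq (β h : ℝ) (Λ : Finset (ℤ × ℤ)) :
    ∃ c : ℝ, 0 < c ∧ ∀ D ⊆ Λ,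
      isingWeight β h Λ (fun _ => true) (minusCfg D) = c * minusWeight β h D := by
  classical
  refine ⟨Real.exp (β * ((∑ x ∈ Λ, ((Λ.filter (fun y => y ∈ nbrs x)).card : ℝ)) / 2 +
    ∑ x ∈ Λ, (((nbrs x).filter (fun y => y ∉ Λ)).card : ℝ)) - h * Λ.card), Real.exp_pos _, ?_⟩
  intro D hD
  set u : ℤ × ℤ → ℝ := fun x => if x ∈ D then 1 else 0 with hu
  have hs : ∀ x, sval (minusCfg D x) = 1 - 2 * u x := by
    intro x
    by_cases hx : x ∈ D
    · simp [sval, minusCfg, hu, hx]; norm_num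
    · simp [sval, minusCfg, hu, hx]
  have hs1 : sval true = 1 := by simp [sval]
  have hcard : ∑ x ∈ Λ, u x = D.card := by
    simp [hu, Finset.inter_eq_right.mpr hD]
  have hdeg : ∀ x, (((nbrs x).filter (fun y => y ∉ Λ)).card : ℝ) =
      4 - (Λ.filter (fun y => y ∈ nbrs x)).card := by
    intro x
    have h1 := Finset.card_filter_add_card_filter_not (s := nbrs x) (fun y => y ∈ Λ)
    have h2 : (nbrs x).filter (fun y => y ∈ Λ) = Λ.filter (fun y => y ∈ nbrs x) := by
      ext y
      simp [and_comm]
    rw [h2, card_nbrs] at h1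
    have h3 : ((Λ.filter (fun y => y ∈ nbrs x)).card : ℝ) +
      ((nbrs x).filter (fun y => y ∉ Λ)).card = 4 := by exact_mod_cast h1
    linarith
  have hin : ∑ x ∈ Λ, ∑ y ∈ Λ.filter (fun y => y ∈ nbrs x), u y =
      ∑ x ∈ Λ, ∑ y ∈ Λ.filter (fun y => y ∈ nbrs x), u x := by
    simp only [Finset.sum_filter]
    rw [Finset.sum_comm]
    refine Finset.sum_congr rfl fun x _ => Finset.sum_congr rfl fun y _ => ?_
    simp only [mem_nbrs_comm (x := y)]
  have hbonds : ∑ x ∈ Λ, u x * ∑ y ∈ Λ.filter (fun y => y ∈ nbrs x), u y = (bonds D).card := by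
    have h1 : ∀ x y, (u x * if y ∈ nbrs x then u y else 0) =
        if (x, y) ∈ bonds D then (1 : ℝ) else 0 := by
      intro x y
      by_cases h1 : x ∈ D <;> by_cases h2 : y ∈ D <;> simp [hu, bonds, h1, h2]
    simp only [Finset.mul_sum, Finset.sum_filter, h1]
    rw [← Finset.sum_product' (f := fun x y => if (x, y) ∈ bonds D then (1 : ℝ) else 0)]
    simp only [Prod.mk.eta, Finset.sum_ite_mem, Finset.sum_const, nsmul_eq_mul, mul_one]
    rw [Finset.inter_eq_right.mpr]
    intro p hp
    simp only [bonds, Finset.mem_filter, Finset.mem_product] at hp ⊢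
    exact ⟨hD hp.1.1, hD hp.1.2⟩
  have hinner : ∑ x ∈ Λ, ∑ y ∈ Λ.filter (fun y => y ∈ nbrs x),
      sval (minusCfg D x) * sval (minusCfg D y) =
      ∑ x ∈ Λ, ((Λ.filter (fun y => y ∈ nbrs x)).card : ℝ) -
        4 * ∑ x ∈ Λ, ((Λ.filter (fun y => y ∈ nbrs x)).card : ℝ) * u x +
          4 * (bonds D).card := by
    have h1 : ∀ x y, sval (minusCfg D x) * sval (minusCfg D y) =
        1 - 2 * u x - 2 * u y + 4 * (u x * u y) := by
      intro x y
      rw [hs, hs]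
      ring
    simp only [h1, Finset.sum_add_distrib, Finset.sum_sub_distrib, ← Finset.mul_sum, hin, hbonds]
    simp only [Finset.sum_const, nsmul_eq_mul, mul_one]
    ring
  have houter : ∑ x ∈ Λ, ∑ y ∈ (nbrs x).filter (fun y => y ∉ Λ),
      sval (minusCfg D x) * sval true =
      ∑ x ∈ Λ, (((nbrs x).filter (fun y => y ∉ Λ)).card : ℝ) -
        2 * (4 * D.card - ∑ x ∈ Λ, ((Λ.filter (fun y => y ∈ nbrs x)).card : ℝ) * u x) := by
    simp only [hs, hs1, mul_one, Finset.sum_const, nsmul_eq_mul]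
    rw [← hcard, Finset.mul_sum, ← Finset.sum_sub_distrib, Finset.mul_sum,
      ← Finset.sum_sub_distrib]
    refine Finset.sum_congr rfl fun x _ => ?_
    rw [hdeg]
    ring
  have hfield : ∑ x ∈ Λ, sval (minusCfg D x) = Λ.card - 2 * D.card := by
    simp only [hs, Finset.sum_sub_distrib, ← Finset.mul_sum, hcard]
    simp
  unfold isingWeight minusWeight
  rw [hinner, houter, hfield, ← Real.exp_add]
  congr 1
  ring

theorem isingFV_plus_apply (β h : ℝ) (Λ : Finset (ℤ × ℤ)) {E : Set Cfg2} (hE : MeasurableSet E) :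
    isingFV β h Λ (fun _ => true) E = ENNReal.ofReal (plusProb β h Λ E) := by
  classical
  obtain ⟨c, hc, hw⟩ := isingWeight_plus_eq β h Λ
  have hnn : ∀ D ∈ Λ.powerset, 0 ≤ c * minusWeight β h D := fun D _ =>
    (mul_pos hc (minusWeight_pos β h D)).le
  have hmass : ∀ F : Set Cfg2, ∑ D ∈ Λ.powerset, (if minusCfg D ∈ F then
      ENNReal.ofReal (isingWeight β h Λ (fun _ => true) (minusCfg D)) else 0) =
        ENNReal.ofReal (c * plusMass β h Λ F) := by
    intro F
    rw [← Finset.sum_filter, plusMass, Finset.mul_sum, ENNReal.ofReal_sum_of_nonneg]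
    · refine Finset.sum_congr rfl fun D hD => ?_
      rw [hw D (Finset.mem_powerset.mp (Finset.mem_filter.mp hD).1)]
    · exact fun D hD => hnn D (Finset.mem_filter.mp hD).1
  have hZ := hmass Set.univ
  simp only [Set.mem_univ, if_true] at hZ
  have hpos : 0 < c * plusMass β h Λ Set.univ := mul_pos hc (plusMass_univ_pos β h Λ)
  simp only [isingFV, Measure.smul_apply, Measure.coe_finsetSum, Finset.sum_apply,
    Measure.dirac_apply' _ hE, smul_eq_mul]
  rw [sum_fill_plus Λ (fun η => ENNReal.ofReal (isingWeight β h Λ (fun _ => true) η)), hZ,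
    sum_fill_plus Λ (fun η => ENNReal.ofReal (isingWeight β h Λ (fun _ => true) η) *
      E.indicator 1 η)]
  have h1 : ∀ D, ENNReal.ofReal (isingWeight β h Λ (fun _ => true) (minusCfg D)) *
      E.indicator 1 (minusCfg D) = if minusCfg D ∈ E then
        ENNReal.ofReal (isingWeight β h Λ (fun _ => true) (minusCfg D)) else 0 := by
    intro D
    by_cases hD : minusCfg D ∈ E <;> simp [hD]
  simp only [h1, hmass]
  rw [mul_comm, ← div_eq_mul_inv, ← ENNReal.ofReal_div_of_pos hpos,
    mul_div_mul_left _ _ hc.ne', plusProb]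

/-- An event depending on finitely many coordinates. -/
def IsLocalEvent {ι : Type*} (E : Set (ι → Bool)) : Prop :=
  ∃ S : Finset ι, ∀ η η' : ι → Bool, (∀ i ∈ S, η i = η' i) → (η ∈ E ↔ η' ∈ E)

theorem IsLocalEvent.of_coord {ι : Type*} (i : ι) (b : Bool) :
    IsLocalEvent {η : ι → Bool | η i = b} :=
  ⟨{i}, fun η η' hη => by simp [hη i (by simp)]⟩

theorem IsLocalEvent.of_cylinder {ι : Type*} (S : Finset ι) (f : ι → Bool) :
    IsLocalEvent {η : ι → Bool | ∀ i ∈ S, η i = f i} :=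
  ⟨S, fun η η' hη => forall₂_congr fun i hi => by rw [hη i hi]⟩

theorem IsLocalEvent.inter {ι : Type*} {E F : Set (ι → Bool)} (hE : IsLocalEvent E)
    (hF : IsLocalEvent F) : IsLocalEvent (E ∩ F) := by
  classical
  obtain ⟨S, hS⟩ := hE
  obtain ⟨T, hT⟩ := hF
  refine ⟨S ∪ T, fun η η' hη => and_congr (hS _ _ fun i hi => hη i ?_) (hT _ _ fun i hi => hη i ?_)⟩
  · exact Finset.mem_union_left _ hi
  · exact Finset.mem_union_right _ hi

theorem IsLocalEvent.preimage {ι κ : Type*} {E : Set (ι → Bool)} (hE : IsLocalEvent E)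
    (g : ι → κ) : IsLocalEvent {η : κ → Bool | (fun i => η (g i)) ∈ E} := by
  classical
  obtain ⟨S, hS⟩ := hE
  exact ⟨S.image g, fun η η' hη => hS _ _ fun i hi => hη _ (Finset.mem_image_of_mem g hi)⟩

theorem IsLocalEvent.exists_eq_biUnion {ι : Type*} {E : Set (ι → Bool)} (hE : IsLocalEvent E) :
    ∃ (S : Finset ι) (T : Finset (ι → Bool)),
      (T : Set (ι → Bool)).PairwiseDisjoint (fun f => {η : ι → Bool | ∀ i ∈ S, η i = f i}) ∧
      E = ⋃ f ∈ T, {η : ι → Bool | ∀ i ∈ S, η i = f i} := by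
  classical
  obtain ⟨S, hS⟩ := hE
  let ext : (S → Bool) → ι → Bool := fun c i => if hi : i ∈ S then c ⟨i, hi⟩ else true
  have hext : ∀ (c : S → Bool) (i : S), ext c i = c i := fun c i => by simp [ext]
  refine ⟨S, (Finset.univ.image ext).filter (· ∈ E), ?_, ?_⟩
  · intro f hf g hg hfg
    refine Set.disjoint_left.mpr fun η hη hη' => hfg ?_
    simp only [Finset.coe_filter, Finset.mem_image, Finset.mem_univ, true_and,
      Set.mem_ofPred_eq] at hf hg
    obtain ⟨⟨c, rfl⟩, _⟩ := hf
    obtain ⟨⟨d, rfl⟩, _⟩ := hg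
    congr 1
    funext i
    rw [← hext c i, ← hext d i, ← hη i i.2, ← hη' i i.2]
  · ext η
    simp only [Finset.mem_filter, Finset.mem_image, Finset.mem_univ, true_and, Set.mem_iUnion,
      Set.mem_ofPred_eq, exists_prop]
    constructor
    · intro hη
      have hloc : ∀ i ∈ S, η i = ext (fun i : S => η i) i := fun i hi =>
        (hext (fun i : S => η i) ⟨i, hi⟩).symm
      exact ⟨ext fun i : S => η i, ⟨⟨fun i : S => η i, rfl⟩, (hS _ _ hloc).mp hη⟩, hloc⟩
    · rintro ⟨f, ⟨-, hf⟩, hη⟩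
      exact (hS _ _ hη).mpr hf

theorem measurableSet_cylinder {ι : Type*} (S : Finset ι) (f : ι → Bool) :
    MeasurableSet {η : ι → Bool | ∀ i ∈ S, η i = f i} := by
  have : {η : ι → Bool | ∀ i ∈ S, η i = f i} = ⋂ i ∈ S, (fun η => η i) ⁻¹' {f i} := by
    ext η
    simp
  rw [this]
  exact Finset.measurableSet_biInter _ fun i _ => measurable_pi_apply i (measurableSet_singleton _)

theorem IsLocalEvent.measurableSet {ι : Type*} {E : Set (ι → Bool)} (hE : IsLocalEvent E) :
    MeasurableSet E := by
  obtain ⟨S, T, -, rfl⟩ := hE.exists_eq_biUnion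
  exact Finset.measurableSet_biUnion _ fun f _ => measurableSet_cylinder S f

theorem CylTendsto.tendsto_of_isLocalEvent {ι : Type*} {μs : ℕ → Measure (ι → Bool)}
    {μ : Measure (ι → Bool)} (hμ : CylTendsto μs μ) {E : Set (ι → Bool)} (hE : IsLocalEvent E) :
    Tendsto (fun n => μs n E) atTop (𝓝 (μ E)) := by
  obtain ⟨S, T, hd, rfl⟩ := hE.exists_eq_biUnion
  simp only [measure_biUnion_finset hd fun f _ => measurableSet_cylinder S f]
  exact tendsto_finsetSum _ fun f _ => hμ S f

/-- Finite measures on binary configurations are determined by the probabilities of the events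
that all spins of a finite set are plus. -/
theorem measure_ext_of_allPlus {ι : Type*} {μ ν : Measure (ι → Bool)} [IsFiniteMeasure μ]
    (hμν : ∀ S : Finset ι, μ {η | ∀ i ∈ S, η i = true} = ν {η | ∀ i ∈ S, η i = true}) :
    μ = ν := by
  classical
  refine ext_of_generate_finite
    (Set.range fun S : Finset ι => {η : ι → Bool | ∀ i ∈ S, η i = true}) ?_ ?_ ?_ ?_
  · apply le_antisymm
    · refine iSup_le fun i => ?_
      rintro _ ⟨s, -, rfl⟩
      have hm : Measurable[MeasurableSpace.generateFrom
          (Set.range fun S : Finset ι => {η : ι → Bool | ∀ i ∈ S, η i = true})]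
          (fun η : ι → Bool => η i) := by
        refine @measurable_to_bool _ (_) _ ?_
        refine MeasurableSpace.measurableSet_generateFrom ⟨{i}, ?_⟩
        ext η
        simp
      exact hm trivial
    · refine MeasurableSpace.generateFrom_le ?_
      rintro _ ⟨S, rfl⟩
      exact measurableSet_cylinder S fun _ => true
  · rintro _ ⟨S, rfl⟩ _ ⟨T, rfl⟩ -
    refine ⟨S ∪ T, ?_⟩
    ext η
    simp only [Finset.mem_union, Set.mem_ofPred_eq, Set.mem_inter_iff]
    exact ⟨fun H => ⟨fun i hi => H i (Or.inl hi), fun i hi => H i (Or.inr hi)⟩,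
      fun H i hi => hi.elim (H.1 i) (H.2 i)⟩
  · rintro _ ⟨S, rfl⟩
    exact hμν S
  · simpa using hμν ∅

theorem IsPlusPhase.tendsto_plusProb {β h : ℝ} {μ : Measure Cfg2} (hμ : IsPlusPhase β h μ)
    {E : Set Cfg2} (hE : IsLocalEvent E) :
    Tendsto (fun n => plusProb β h (box n) E) atTop (𝓝 (μ.real E)) := by
  have := hμ.1
  have h1 := hμ.2.tendsto_of_isLocalEvent hE
  simp only [isingFV_plus_apply β h _ hE.measurableSet] at h1
  have h2 := (ENNReal.tendsto_toReal (measure_ne_top μ E)).comp h1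
  refine h2.congr fun n => ?_
  exact ENNReal.toReal_ofReal (plusProb_nonneg β h _ _)

theorem measurable_lineProj : Measurable lineProj :=
  measurable_pi_lambda _ fun i => measurable_pi_apply ((i, 0) : ℤ × ℤ)

theorem isProbabilityMeasure_schonmann {μ : Measure Cfg2} [IsProbabilityMeasure μ] :
    IsProbabilityMeasure (schonmann μ) :=
  Measure.isProbabilityMeasure_map measurable_lineProj.aemeasurable

theorem IsLocalEvent.lineProj {E : Set (ZSeq Bool)} (hE : IsLocalEvent E) :
    IsLocalEvent (lineProj ⁻¹' E) :=
  hE.preimage fun i : ℤ => ((i, 0) : ℤ × ℤ)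

theorem tendsto_plusProb_schonmann {β h : ℝ} {μ : Measure Cfg2} (hμ : IsPlusPhase β h μ)
    {E : Set (ZSeq Bool)} (hE : IsLocalEvent E) :
    Tendsto (fun n => plusProb β h (box n) (lineProj ⁻¹' E)) atTop
      (𝓝 ((schonmann μ).real E)) := by
  have := hμ.tendsto_plusProb hE.lineProj
  rwa [← map_measureReal_apply measurable_lineProj hE.measurableSet] at this

/-- Ahlswede–Daykin inequality for the Schonmann projection. -/
theorem schonmann_mul_le {β h : ℝ} (hβ : 0 < β) {μ : Measure Cfg2} (hμ : IsPlusPhase β h μ)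
    {E F G H : Set (ZSeq Bool)} (hE : IsLocalEvent E) (hF : IsLocalEvent F) (hG : IsLocalEvent G)
    (hH : IsLocalEvent H) (hEF : ∀ a ∈ E, ∀ b ∈ F, a ⊓ b ∈ G ∧ a ⊔ b ∈ H) :
    (schonmann μ).real E * (schonmann μ).real F ≤ (schonmann μ).real G * (schonmann μ).real H :=
  le_of_tendsto_of_tendsto'
    ((tendsto_plusProb_schonmann hμ hE).mul (tendsto_plusProb_schonmann hμ hF))
    ((tendsto_plusProb_schonmann hμ hG).mul (tendsto_plusProb_schonmann hμ hH))
    fun n => plusProb_mul_le hβ h (box n) fun _ ha _ hb => hEF _ ha _ hb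

theorem box_mono {m n : ℕ} (hmn : m ≤ n) : box m ⊆ box n := by
  intro x hx
  simp only [box, Finset.mem_product, Finset.mem_Icc] at hx ⊢
  omega

/-- Conditioning the Schonmann projection on plus spins off the interval `[-n, n]` is dominated by
the plus measure of the box `[-n, n]²`. -/
theorem schonmann_inter_le {β h : ℝ} (hβ : 0 < β) {μ : Measure Cfg2} (hμ : IsPlusPhase β h μ)
    {A : Set (ZSeq Bool)} (hA : IsLocalEvent A) (hA' : IsUpperSet A) (n : ℕ) {S : Finset ℤ}
    (hS : ∀ i ∈ S, i < -(n : ℤ)) :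
    (schonmann μ).real (A ∩ {η | ∀ i ∈ S, η i = true}) ≤
      (schonmann μ).real {η | ∀ i ∈ S, η i = true} * plusProb β h (box n) (lineProj ⁻¹' A) := by
  have hB : IsLocalEvent {η : ZSeq Bool | ∀ i ∈ S, η i = true} :=
    IsLocalEvent.of_cylinder S fun _ => true
  refine le_of_tendsto_of_tendsto (tendsto_plusProb_schonmann hμ (hA.inter hB))
    ((tendsto_plusProb_schonmann hμ hB).mul_const _) ?_
  filter_upwards [eventually_ge_atTop n] with N hN
  refine plusProb_inter_le hβ h (box_mono hN) (fun _ _ hab ha => hA' (fun i => hab (i, 0)) ha) ?_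
  intro a ha b hb i hi
  have h1 : a (i, 0) = true := ha i hi
  have h2 : b (i, 0) = true := hb (i, 0) fun hmem => by
    have := hS i hi
    simp only [box, Finset.mem_product, Finset.mem_Icc] at hmem
    omega
  simp [lineProj, h1, h2]

theorem schonmann_cylinder_pos {β h : ℝ} (hβ : 0 < β) {μ : Measure Cfg2}
    (hμ : IsPlusPhase β h μ) (S : Finset ℤ) (f : ℤ → Bool) :
    0 < (schonmann μ).real {η | ∀ i ∈ S, η i = f i} := by
  have hlim := tendsto_plusProb_schonmann hμ (IsLocalEvent.of_cylinder S f)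
  have hK : 0 < ((1 + Real.exp (16 * β + |8 * β - 2 * h|))⁻¹) ^
      (S.map ⟨fun i : ℤ => ((i, 0) : ℤ × ℤ), Prod.mk_left_injective 0⟩).card := by positivity
  refine hK.trans_le (ge_of_tendsto hlim ?_)
  obtain ⟨N, hN⟩ : ∃ N : ℕ, ∀ i ∈ S, i.natAbs ≤ N :=
    ⟨S.sup Int.natAbs, fun i hi => Finset.le_sup (f := Int.natAbs) hi⟩
  filter_upwards [eventually_ge_atTop N] with n hn
  have h1 := plusProb_cylinder_ge hβ h (Λ := box n) (fun x => f x.1)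
    (S.map ⟨fun i : ℤ => ((i, 0) : ℤ × ℤ), Prod.mk_left_injective 0⟩) (by
      intro x hx
      simp only [Finset.mem_map, Function.Embedding.coeFn_mk] at hx
      obtain ⟨i, hi, rfl⟩ := hx
      have := hN i hi
      simp only [box, Finset.mem_product, Finset.mem_Icc]
      omega)
  refine h1.trans_eq ?_
  congr 1
  ext η
  simp [lineProj]

theorem map_shiftSeq_schonmann {β h : ℝ} (hβ : 0 < β) {μ : Measure Cfg2}
    (hμ : IsPlusPhase β h μ) : (schonmann μ).map shiftSeq = schonmann μ := by
  have := hμ.1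
  have := isProbabilityMeasure_schonmann (μ := μ)
  have hm : Measurable (shiftSeq (A := Bool)) :=
    measurable_pi_lambda _ fun i => measurable_pi_apply (i + 1)
  have := Measure.isProbabilityMeasure_map (μ := schonmann μ) hm.aemeasurable
  refine measure_ext_of_allPlus fun S => ?_
  set A : Set (ZSeq Bool) := {η | ∀ i ∈ S, η i = true} with hA
  have hAloc : IsLocalEvent A := IsLocalEvent.of_cylinder S fun _ => true
  have hBloc : IsLocalEvent (shiftSeq ⁻¹' A) := hAloc.preimage fun i : ℤ => i + 1
  rw [Measure.map_apply hm hAloc.measurableSet]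
  refine (measureReal_eq_measureReal_iff (measure_ne_top _ _) (measure_ne_top _ _)).mp ?_
  have hup : IsUpperSet (lineProj ⁻¹' (shiftSeq ⁻¹' A)) := by
    intro a b hab ha i hi
    have h1 := hab (i + 1, 0)
    rw [show a (i + 1, 0) = true from ha i hi] at h1
    exact top_le_iff.mp h1
  have hshift : ∀ n, plusProb β h ((box n).map siteShift) (lineProj ⁻¹' (shiftSeq ⁻¹' A)) =
      plusProb β h (box n) (lineProj ⁻¹' A) := by
    intro n
    rw [plusProb_map_siteShift]
    congr 1
    ext η
    simp [lineProj, shiftSeq, hA]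
  have hlimA := tendsto_plusProb_schonmann hμ hAloc
  have hlimB := tendsto_plusProb_schonmann hμ hBloc
  refine le_antisymm ?_ ?_
  · refine le_of_tendsto_of_tendsto' (hlimB.comp (tendsto_add_atTop_nat 1)) hlimA fun n => ?_
    rw [← hshift]
    refine plusProb_anti hβ h ?_ hup
    intro x hx
    obtain ⟨y, hy, rfl⟩ := Finset.mem_map.mp hx
    simp only [box, Finset.mem_product, Finset.mem_Icc, siteShift_apply] at hy ⊢
    omega
  · refine le_of_tendsto_of_tendsto' (hlimA.comp (tendsto_add_atTop_nat 1)) hlimB fun n => ?_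
    simp only [Function.comp]
    rw [← hshift]
    refine plusProb_anti hβ h ?_ hup
    intro x hx
    refine Finset.mem_map.mpr ⟨(x.1 - 1, x.2), ?_, by simp [siteShift_apply]⟩
    simp only [box, Finset.mem_product, Finset.mem_Icc] at hx ⊢
    push_cast
    omega

theorem cond_real_apply {Ω : Type*} [MeasurableSpace Ω] {s : Set Ω} (hs : MeasurableSet s)
    (μ : Measure Ω) (t : Set Ω) : (μ[|s]).real t = (μ.real s)⁻¹ * μ.real (s ∩ t) := by
  rw [Measure.real, cond_apply hs, ENNReal.toReal_mul, ENNReal.toReal_inv]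
  rfl

theorem schonmann_le_cond {β h : ℝ} (hβ : 0 < β) {μ : Measure Cfg2} (hμ : IsPlusPhase β h μ)
    {A : Set (ZSeq Bool)} (hA : IsLocalEvent A) (hA' : IsUpperSet A) (S : Finset ℤ) :
    (schonmann μ).real A ≤ ((schonmann μ)[|{η | ∀ i ∈ S, η i = true}]).real A := by
  have := hμ.1
  have := isProbabilityMeasure_schonmann (μ := μ)
  have hB : IsLocalEvent {η : ZSeq Bool | ∀ i ∈ S, η i = true} :=
    IsLocalEvent.of_cylinder S fun _ => true
  have hpos := schonmann_cylinder_pos hβ hμ S fun _ => true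
  rw [cond_real_apply hB.measurableSet, ← div_eq_inv_mul, le_div_iff₀ hpos]
  have := schonmann_mul_le hβ hμ (E := A) (F := {η | ∀ i ∈ S, η i = true}) (G := Set.univ)
    (H := {η | ∀ i ∈ S, η i = true} ∩ A) hA hB ⟨∅, by simp⟩ (hB.inter hA)
    (fun a ha b hb => ⟨trivial, fun i hi => by simp [hb i hi], hA' le_sup_left ha⟩)
  simpa using this

theorem cond_schonmann_le {β h : ℝ} (hβ : 0 < β) {μ : Measure Cfg2} (hμ : IsPlusPhase β h μ)
    {A : Set (ZSeq Bool)} (hA : IsLocalEvent A) (hA' : IsUpperSet A) (n : ℕ) {S : Finset ℤ}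
    (hS : ∀ i ∈ S, i < -(n : ℤ)) :
    ((schonmann μ)[|{η | ∀ i ∈ S, η i = true}]).real A ≤
      plusProb β h (box n) (lineProj ⁻¹' A) := by
  have := hμ.1
  have := isProbabilityMeasure_schonmann (μ := μ)
  have hpos := schonmann_cylinder_pos hβ hμ S fun _ => true
  rw [cond_real_apply (measurableSet_cylinder S fun _ => true), ← div_eq_inv_mul,
    div_le_iff₀ hpos, mul_comm, Set.inter_comm]
  exact schonmann_inter_le hβ hμ hA hA' n hS

theorem isUpperSet_allPlus {ι : Type*} (S : Finset ι) :
    IsUpperSet {η : ι → Bool | ∀ i ∈ S, η i = true} := by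
  intro a b hab ha i hi
  have h1 := hab i
  rw [ha i hi] at h1
  exact top_le_iff.mp h1

theorem blockEvt_eq_cylinder (n l : ℕ) (b : Bool) :
    blockEvt n l b = {η | ∀ i ∈ Finset.Icc (-((n : ℤ) + l)) (-(n : ℤ)), η i = b} := by
  ext η
  simp [blockEvt]

theorem schonmann_eq_condLimit {β h : ℝ} (hβ : 0 < β) {μ : Measure Cfg2}
    (hμ : IsPlusPhase β h μ) {ν' : Measure (ZSeq Bool)}
    (hν' : IsCondLimitMeasure (schonmann μ) true ν') : schonmann μ = ν' := by
  have := hμ.1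
  have := isProbabilityMeasure_schonmann (μ := μ)
  obtain ⟨νs, h1, h2⟩ := hν'
  refine measure_ext_of_allPlus fun S => ?_
  set A : Set (ZSeq Bool) := {η | ∀ i ∈ S, η i = true} with hA
  have hAloc : IsLocalEvent A := IsLocalEvent.of_cylinder S fun _ => true
  have hAup : IsUpperSet A := isUpperSet_allPlus S
  have hlim : Tendsto (fun n => νs n A) atTop (𝓝 (ν' A)) := h2.tendsto_of_isLocalEvent hAloc
  have hcond : ∀ n l, (schonmann μ)[|blockEvt n l true] A =
      ENNReal.ofReal (((schonmann μ)[|blockEvt n l true]).real A) := fun n l =>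
    (ofReal_measureReal (measure_ne_top _ _)).symm
  have hinner : ∀ n, Tendsto (fun l => (schonmann μ)[|blockEvt n l true] A) atTop
      (𝓝 (νs n A)) := fun n => (h1 n).tendsto_of_isLocalEvent hAloc
  refine le_antisymm ?_ ?_
  · refine ge_of_tendsto' hlim fun n => ge_of_tendsto' (hinner n) fun l => ?_
    rw [hcond, ← ofReal_measureReal (measure_ne_top (schonmann μ) A), blockEvt_eq_cylinder]
    exact ENNReal.ofReal_le_ofReal (schonmann_le_cond hβ hμ hAloc hAup _)
  · rw [← ofReal_measureReal (measure_ne_top (schonmann μ) A)]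
    refine le_of_tendsto_of_tendsto' (hlim.comp (tendsto_add_atTop_nat 1))
      (ENNReal.tendsto_ofReal (tendsto_plusProb_schonmann hμ hAloc)) fun n => ?_
    refine le_of_tendsto' (hinner (n + 1)) fun l => ?_
    rw [hcond, blockEvt_eq_cylinder]
    refine ENNReal.ofReal_le_ofReal (cond_schonmann_le hβ hμ hAloc hAup n fun i hi => ?_)
    rw [Finset.mem_Icc] at hi
    push_cast at hi
    omega

/-- The last `n` spins of the past. -/
def recentPast (n : ℕ) (η : ZSeq Bool) : Fin n → Bool := fun k => restrictPast η k

theorem measurable_restrictPast : Measurable (restrictPast (A := Bool)) :=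
  measurable_pi_lambda _ fun k => measurable_pi_apply (-(k + 1 : ℤ))

theorem measurable_recentPast (n : ℕ) : Measurable (recentPast n) :=
  measurable_pi_lambda _ fun k => measurable_pi_apply (-((k : ℕ) + 1 : ℤ))

theorem IsLocalEvent.recentPast_preimage {n : ℕ} (T : Set (Fin n → Bool)) :
    IsLocalEvent (recentPast n ⁻¹' T) := by
  have hT : IsLocalEvent T := ⟨Finset.univ, fun η η' hη => by
    rw [show η = η' from funext fun i => hη i (Finset.mem_univ i)]⟩
  exact hT.preimage fun k : Fin n => (-((k : ℕ) + 1 : ℤ))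

theorem pastEvt_eq (n l : ℕ) (b : Bool) (ω : Past Bool) :
    pastEvt n l b ω = recentPast n ⁻¹' ({fun k : Fin n => ω k} : Set (Fin n → Bool)) ∩
      {η | ∀ i ∈ Finset.Icc (-((n : ℤ) + l)) (-((n : ℤ) + 1)), η i = b} := by
  ext η
  simp only [pastEvt, Set.mem_ofPred_eq, Set.mem_inter_iff, Set.mem_preimage,
    Set.mem_singleton_iff, Finset.mem_Icc, and_imp, funext_iff, recentPast, restrictPast]
  refine and_congr ⟨fun H k => ?_, fun H i h1 h2 => ?_⟩ Iff.rfl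
  · have := H (-((k : ℕ) + 1 : ℤ)) (by omega) (by omega)
    rw [this]
    congr 1
  · have := H ⟨i.natAbs - 1, by omega⟩
    simp only at this
    rw [← this]
    congr 1
    omega

/-- Integrating over a union of cells the conditional probabilities given the cells of a finite
partition. -/
theorem setIntegral_cond_fiber {Ω α : Type*} [MeasurableSpace Ω] [MeasurableSpace α] [Fintype α]
    [MeasurableSingletonClass α] (ρ : Measure Ω) [IsFiniteMeasure ρ] {X : Ω → α}
    (hX : Measurable X) (A : Set Ω) (T : Set α) :
    ∫ η in X ⁻¹' T, (ρ[|X ⁻¹' {X η}]).real A ∂ρ = ρ.real (A ∩ X ⁻¹' T) := by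
  classical
  have hT : MeasurableSet T := T.toFinite.measurableSet
  have h1 : ∀ η, (X ⁻¹' T).indicator (fun η => (ρ[|X ⁻¹' {X η}]).real A) η =
      (fun c => (ρ[|X ⁻¹' {c}]).real (A ∩ X ⁻¹' T)) (X η) := by
    intro η
    by_cases hη : X η ∈ T
    · rw [Set.indicator_of_mem (show η ∈ X ⁻¹' T from hη)]
      simp only [cond_real_apply (hX (measurableSet_singleton _))]
      congr 2
      ext ξ
      simp only [Set.mem_inter_iff, Set.mem_preimage, Set.mem_singleton_iff]
      constructor
      · rintro ⟨h1, h2⟩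
        exact ⟨h1, h2, h1 ▸ hη⟩
      · rintro ⟨h1, h2, -⟩
        exact ⟨h1, h2⟩
    · rw [Set.indicator_of_notMem (show η ∉ X ⁻¹' T from hη)]
      simp only [cond_real_apply (hX (measurableSet_singleton _))]
      rw [show X ⁻¹' {X η} ∩ (A ∩ X ⁻¹' T) = ∅ from ?_]
      · simp
      · ext ξ
        simp only [Set.mem_inter_iff, Set.mem_preimage, Set.mem_singleton_iff,
          Set.mem_empty_iff_false, iff_false]
        rintro ⟨h1, -, h3⟩
        exact hη (h1 ▸ h3)
  rw [← integral_indicator (hX hT), integral_congr_ae (Eventually.of_forall h1),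
    ← integral_map hX.aemeasurable (f := fun c => (ρ[|X ⁻¹' {c}]).real (A ∩ X ⁻¹' T))
      (measurable_of_finite _).aestronglyMeasurable, integral_fintype Integrable.of_finite]
  have h2 := congrArg (fun m : Measure Ω => m.real (A ∩ X ⁻¹' T)) (sum_meas_smul_cond_fiber hX ρ)
  rw [← h2, Measure.real, Measure.finsetSum_apply, ENNReal.toReal_sum (by
    intro c _
    exact ENNReal.mul_ne_top (measure_ne_top _ _) (measure_ne_top _ _))]
  simp only [← Measure.real_def]
  simp only [smul_eq_mul, measureReal_ennreal_smul_apply,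
    map_measureReal_apply hX (measurableSet_singleton _)]
  rfl

theorem integral_le_integral_of_meas_le {Ω : Type*} [MeasurableSpace Ω] {ρ ρ' : Measure Ω}
    [IsProbabilityMeasure ρ] [IsProbabilityMeasure ρ'] {g : Ω → ℝ} (hg : Measurable g)
    (h0 : ∀ η, 0 ≤ g η) (h1 : ∀ η, g η ≤ 1) (hle : ∀ t : ℝ, ρ {η | t ≤ g η} ≤ ρ' {η | t ≤ g η}) :
    ∫ η, g η ∂ρ ≤ ∫ η, g η ∂ρ' := by
  rw [integral_eq_lintegral_of_nonneg_ae (Eventually.of_forall h0) hg.aestronglyMeasurable,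
    integral_eq_lintegral_of_nonneg_ae (Eventually.of_forall h0) hg.aestronglyMeasurable]
  refine ENNReal.toReal_mono ?_ ?_
  · refine ne_top_of_le_ne_top (b := 1) (by simp) ?_
    calc ∫⁻ η, ENNReal.ofReal (g η) ∂ρ' ≤ ∫⁻ _, 1 ∂ρ' :=
          lintegral_mono fun η => by simpa using h1 η
      _ = 1 := by simp
  · rw [lintegral_eq_lintegral_meas_le _ (Eventually.of_forall h0) hg.aemeasurable,
      lintegral_eq_lintegral_meas_le _ (Eventually.of_forall h0) hg.aemeasurable]
    exact lintegral_mono fun t => hle t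

/-- Holley-type comparison of conditional probabilities of increasing events. -/
theorem schonmann_cond_mono {β h : ℝ} (hβ : 0 < β) {μ : Measure Cfg2} (hμ : IsPlusPhase β h μ)
    {A D D' : Set (ZSeq Bool)} (hA : IsLocalEvent A) (hA' : IsUpperSet A) (hD : IsLocalEvent D)
    (hD' : IsLocalEvent D') (hpos : 0 < (schonmann μ).real D) (hpos' : 0 < (schonmann μ).real D')
    (hDD' : ∀ a ∈ D, ∀ b ∈ D', a ⊓ b ∈ D ∧ a ⊔ b ∈ D') :
    ((schonmann μ)[|D]).real A ≤ ((schonmann μ)[|D']).real A := by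
  rw [cond_real_apply hD.measurableSet, cond_real_apply hD'.measurableSet, ← div_eq_inv_mul,
    ← div_eq_inv_mul, div_le_div_iff₀ hpos hpos']
  have := schonmann_mul_le hβ hμ (hD.inter hA) hD' hD (hD'.inter hA) fun a ha b hb =>
    ⟨(hDD' a ha.1 b hb).1, (hDD' a ha.1 b hb).2, hA' le_sup_left ha.2⟩
  linarith

theorem isLocalEvent_pastEvt (n l : ℕ) (b : Bool) (ω : Past Bool) :
    IsLocalEvent (pastEvt n l b ω) := by
  rw [pastEvt_eq]
  exact (IsLocalEvent.recentPast_preimage _).inter (IsLocalEvent.of_cylinder _ fun _ => b)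

theorem schonmann_pastEvt_pos {β h : ℝ} (hβ : 0 < β) {μ : Measure Cfg2}
    (hμ : IsPlusPhase β h μ) (n l : ℕ) (b : Bool) (ω : Past Bool) :
    0 < (schonmann μ).real (pastEvt n l b ω) := by
  have := schonmann_cylinder_pos hβ hμ (Finset.Icc (-((n : ℤ) + l)) (-1))
    fun i => if -(n : ℤ) ≤ i then ω (i.natAbs - 1) else b
  convert this using 2
  ext η
  simp only [pastEvt, Set.mem_ofPred_eq, Finset.mem_Icc, and_imp]
  constructor
  · rintro ⟨H1, H2⟩ i h1 h2
    split_ifs with h3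
    · exact H1 i h3 h2
    · exact H2 i h1 (by omega)
  · intro H
    refine ⟨fun i h1 h2 => ?_, fun i h1 h2 => ?_⟩
    · rw [H i (by omega) h2, if_pos h1]
    · rw [H i h1 (by omega), if_neg (by omega)]

theorem pastEvt_zero (n : ℕ) (b : Bool) (ω : Past Bool) :
    pastEvt n 0 b ω = recentPast n ⁻¹' ({fun k : Fin n => ω k} : Set (Fin n → Bool)) := by
  rw [pastEvt_eq, Set.inter_eq_left]
  intro η _ i hi
  rw [Finset.mem_Icc] at hi
  push_cast at hi
  omega

theorem condProbR_pastEvt_mono {β h : ℝ} (hβ : 0 < β) {μ : Measure Cfg2}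
    (hμ : IsPlusPhase β h μ) {A : Set (ZSeq Bool)} (hA : IsLocalEvent A) (hA' : IsUpperSet A)
    (n l : ℕ) {ω ω' : Past Bool} (hω : ω ≤ ω') :
    condProbR (schonmann μ) A (pastEvt n l true ω) ≤
      condProbR (schonmann μ) A (pastEvt n l true ω') := by
  refine schonmann_cond_mono hβ hμ hA hA' (isLocalEvent_pastEvt n l true ω)
    (isLocalEvent_pastEvt n l true ω') (schonmann_pastEvt_pos hβ hμ n l true ω)
    (schonmann_pastEvt_pos hβ hμ n l true ω') ?_
  rintro a ⟨ha1, ha2⟩ b ⟨hb1, hb2⟩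
  refine ⟨⟨fun i h1 h2 => ?_, fun i h1 h2 => ?_⟩, fun i h1 h2 => ?_, fun i h1 h2 => ?_⟩
  · rw [Pi.inf_apply, ha1 i h1 h2, hb1 i h1 h2, inf_eq_left.mpr (hω _)]
  · simp [ha2 i h1 h2, hb2 i h1 h2]
  · rw [Pi.sup_apply, ha1 i h1 h2, hb1 i h1 h2, sup_eq_right.mpr (hω _)]
  · simp [ha2 i h1 h2, hb2 i h1 h2]

theorem condProbR_nonneg {Ω : Type*} [MeasurableSpace Ω] (ρ : Measure Ω) (A D : Set Ω) :
    0 ≤ condProbR ρ A D :=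
  ENNReal.toReal_nonneg

theorem condProbR_le_one {Ω : Type*} [MeasurableSpace Ω] (ρ : Measure Ω) (A D : Set Ω) :
    condProbR ρ A D ≤ 1 :=
  measureReal_le_one

theorem condProbR_pastEvt_eq (ν : Measure (ZSeq Bool)) (A : Set (ZSeq Bool)) (n l : ℕ) (b : Bool)
    (ω : Past Bool) :
    condProbR ν A (pastEvt n l b ω) =
      (fun c : Fin n → Bool => condProbR ν A (recentPast n ⁻¹' {c} ∩
        {η | ∀ i ∈ Finset.Icc (-((n : ℤ) + l)) (-((n : ℤ) + 1)), η i = b}))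
      (fun k : Fin n => ω k) := by
  rw [pastEvt_eq]

theorem measurable_condProbR_pastEvt (ν : Measure (ZSeq Bool)) (A : Set (ZSeq Bool)) (n l : ℕ)
    (b : Bool) : Measurable fun ω => condProbR ν A (pastEvt n l b ω) := by
  have hG : Measurable fun c : Fin n → Bool => condProbR ν A (recentPast n ⁻¹' {c} ∩
      {η | ∀ i ∈ Finset.Icc (-((n : ℤ) + l)) (-((n : ℤ) + 1)), η i = b}) := measurable_of_finite _
  simp only [condProbR_pastEvt_eq]
  exact hG.comp (measurable_pi_lambda _ fun k : Fin n => measurable_pi_apply (k : ℕ))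

theorem integral_condProbR_pastEvt_le {β h : ℝ} (hβ : 0 < β) {μ : Measure Cfg2}
    (hμ : IsPlusPhase β h μ) {A : Set (ZSeq Bool)} (hA : IsLocalEvent A) (hA' : IsUpperSet A)
    (n l : ℕ) :
    ∫ η, condProbR (schonmann μ) A (pastEvt n l true (restrictPast η)) ∂schonmann μ ≤
      plusProb β h (box n) (lineProj ⁻¹' A) := by
  have := hμ.1
  have := isProbabilityMeasure_schonmann (μ := μ)
  set S := Finset.Icc (-((n : ℤ) + l)) (-((n : ℤ) + 1)) with hS
  have hBm := measurableSet_cylinder S fun _ => true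
  have hpos := schonmann_cylinder_pos hβ hμ S fun _ => true
  have : IsProbabilityMeasure ((schonmann μ)[|{η | ∀ i ∈ S, η i = true}]) :=
    cond_isProbabilityMeasure fun h0 => by simp [Measure.real, h0] at hpos
  refine le_trans (integral_le_integral_of_meas_le
    (ρ' := (schonmann μ)[|{η | ∀ i ∈ S, η i = true}])
    ((measurable_condProbR_pastEvt _ A n l true).comp measurable_restrictPast)
    (fun η => condProbR_nonneg _ _ _) (fun η => condProbR_le_one _ _ _) fun t => ?_) ?_
  · refine (ENNReal.toReal_le_toReal (measure_ne_top _ _) (measure_ne_top _ _)).mp ?_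
    refine schonmann_le_cond hβ hμ ?_ (fun η η' hη ht => ?_) S
    · simp only [condProbR_pastEvt_eq]
      exact IsLocalEvent.recentPast_preimage {c : Fin n → Bool | t ≤ condProbR (schonmann μ) A
        (recentPast n ⁻¹' {c} ∩ {η | ∀ i ∈ S, η i = true})}
    · exact le_trans ht (condProbR_pastEvt_mono hβ hμ hA hA' n l fun k => hη _)
  · refine le_trans (le_of_eq ?_) (cond_schonmann_le hβ hμ hA hA' n (S := S) fun i hi => ?_)
    · have := setIntegral_cond_fiber ((schonmann μ)[|{η | ∀ i ∈ S, η i = true}])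
        (measurable_recentPast n) A Set.univ
      rw [Set.preimage_univ, Set.inter_univ, Measure.restrict_univ] at this
      rw [← this]
      refine integral_congr_ae (Eventually.of_forall fun η => ?_)
      simp only
      rw [pastEvt_eq, cond_cond_eq_cond_inter hBm
        (measurable_recentPast n (measurableSet_singleton _)), Set.inter_comm]
      rfl
    · rw [hS, Finset.mem_Icc] at hi
      omega

theorem schonmann_inter_le_setIntegral {β h : ℝ} (hβ : 0 < β) {μ : Measure Cfg2}
    (hμ : IsPlusPhase β h μ) {A : Set (ZSeq Bool)} (hA : IsLocalEvent A) (hA' : IsUpperSet A)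
    (n l : ℕ) (T : Set (Fin n → Bool)) :
    (schonmann μ).real (A ∩ recentPast n ⁻¹' T) ≤
      ∫ η in recentPast n ⁻¹' T,
        condProbR (schonmann μ) A (pastEvt n l true (restrictPast η)) ∂schonmann μ := by
  have := hμ.1
  have := isProbabilityMeasure_schonmann (μ := μ)
  have hint : ∀ k, Integrable (fun η => condProbR (schonmann μ) A
      (pastEvt n k true (restrictPast η))) ((schonmann μ).restrict (recentPast n ⁻¹' T)) :=
    fun k => Integrable.of_bound ((measurable_condProbR_pastEvt _ A n k true).comp
      measurable_restrictPast).aestronglyMeasurable 1 (Eventually.of_forall fun η => by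
        simpa [abs_of_nonneg (condProbR_nonneg _ _ _)] using condProbR_le_one _ _ _)
  rw [← setIntegral_cond_fiber (schonmann μ) (measurable_recentPast n) A T]
  have h0 : ∀ η, ((schonmann μ)[|recentPast n ⁻¹' {recentPast n η}]).real A =
      condProbR (schonmann μ) A (pastEvt n 0 true (restrictPast η)) := fun η => by
    rw [pastEvt_zero]
    rfl
  simp only [h0]
  refine integral_mono (hint 0) (hint l) fun η => ?_
  refine schonmann_cond_mono hβ hμ hA hA' (isLocalEvent_pastEvt n 0 true _)
    (isLocalEvent_pastEvt n l true _) (schonmann_pastEvt_pos hβ hμ n 0 true _)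
    (schonmann_pastEvt_pos hβ hμ n l true _) ?_
  rintro a ⟨ha1, -⟩ b ⟨hb1, hb2⟩
  refine ⟨⟨fun i h1 h2 => ?_, fun i h1 h2 => ?_⟩, fun i h1 h2 => ?_, fun i h1 h2 => ?_⟩
  · rw [Pi.inf_apply, ha1 i h1 h2, hb1 i h1 h2, inf_idem]
  · push_cast at h1
    omega
  · rw [Pi.sup_apply, ha1 i h1 h2, hb1 i h1 h2, sup_idem]
  · simp [hb2 i h1 h2]

theorem tendsto_setIntegral_of_mem_Icc {Ω : Type*} [MeasurableSpace Ω] {ρ : Measure Ω}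
    [IsFiniteMeasure ρ] {f : ℕ → Ω → ℝ} {g : Ω → ℝ} (hf : ∀ n, Measurable (f n))
    (hf' : ∀ n η, f n η ∈ Set.Icc (0 : ℝ) 1)
    (hfg : ∀ η, Tendsto (fun n => f n η) atTop (𝓝 (g η))) (C : Set Ω) :
    Tendsto (fun n => ∫ η in C, f n η ∂ρ) atTop (𝓝 (∫ η in C, g η ∂ρ)) :=
  tendsto_integral_of_dominated_convergence (fun _ => 1)
    (fun n => (hf n).aestronglyMeasurable) (integrable_const 1)
    (fun n => Eventually.of_forall fun η => by
      rw [Real.norm_of_nonneg (hf' n η).1]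
      exact (hf' n η).2)
    (Eventually.of_forall hfg)

theorem IsLocalEvent.exists_recentPast_preimage {C : Set (Past Bool)} (hC : IsLocalEvent C) :
    ∃ m, ∀ n ≥ m, ∃ T : Set (Fin n → Bool), restrictPast ⁻¹' C = recentPast n ⁻¹' T := by
  obtain ⟨S, hS⟩ := hC
  refine ⟨S.sup id + 1, fun n hn =>
    ⟨{c | (fun k => if hk : k < n then c ⟨k, hk⟩ else true) ∈ C}, ?_⟩⟩
  ext η
  refine hS _ _ fun i hi => ?_
  have h1 : i ≤ S.sup id := Finset.le_sup (f := id) hi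
  have h2 : i < n := by omega
  simp [h2, recentPast]

section Limits

variable {ν : Measure (ZSeq Bool)} {b : Bool} {P : Bool → Past Bool → ℝ}

theorem IsCondG.mem_Icc (hP : IsCondG ν b P) (a : Bool) (ω : Past Bool) :
    P a ω ∈ Set.Icc (0 : ℝ) 1 := by
  obtain ⟨L, h1, h2⟩ := hP a ω
  exact isClosed_Icc.mem_of_tendsto h2 (Eventually.of_forall fun n =>
    isClosed_Icc.mem_of_tendsto (h1 n) (Eventually.of_forall fun l =>
      ⟨condProbR_nonneg _ _ _, condProbR_le_one _ _ _⟩))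

theorem IsCondG.measurable (hP : IsCondG ν b P) (a : Bool) : Measurable (P a) := by
  choose L h1 h2 using hP a
  refine measurable_of_tendsto_metrizable (f := fun n ω => L ω n) (fun n => ?_)
    (tendsto_pi_nhds.mpr h2)
  exact measurable_of_tendsto_metrizable
    (fun l => measurable_condProbR_pastEvt ν {η | η 0 = a} n l b)
    (tendsto_pi_nhds.mpr fun ω => h1 ω n)

/-- Integrals of the approximating conditional probabilities converge to those of the limiting
g-function. -/
theorem IsCondG.tendsto_setIntegral [IsFiniteMeasure ν] (hP : IsCondG ν b P) (a : Bool) :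
    ∃ F : ℕ → ZSeq Bool → ℝ, ∀ C : Set (ZSeq Bool),
      (∀ n, Tendsto (fun l => ∫ η in C, condProbR ν {η | η 0 = a}
        (pastEvt n l b (restrictPast η)) ∂ν) atTop (𝓝 (∫ η in C, F n η ∂ν))) ∧
      Tendsto (fun n => ∫ η in C, F n η ∂ν) atTop (𝓝 (∫ η in C, P a (restrictPast η) ∂ν)) := by
  choose L h1 h2 using hP a
  have hL : ∀ n, Measurable fun ω => L ω n := fun n =>
    measurable_of_tendsto_metrizable
      (fun l => measurable_condProbR_pastEvt ν {η | η 0 = a} n l b)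
      (tendsto_pi_nhds.mpr fun ω => h1 ω n)
  refine ⟨fun n η => L (restrictPast η) n, fun C => ⟨fun n => ?_, ?_⟩⟩
  · exact tendsto_setIntegral_of_mem_Icc
      (fun l => (measurable_condProbR_pastEvt ν _ n l b).comp measurable_restrictPast)
      (fun l η => ⟨condProbR_nonneg _ _ _, condProbR_le_one _ _ _⟩)
      (fun η => h1 (restrictPast η) n) C
  · exact tendsto_setIntegral_of_mem_Icc (fun n => (hL n).comp measurable_restrictPast)
      (fun n η => isClosed_Icc.mem_of_tendsto (h1 (restrictPast η) n)
        (Eventually.of_forall fun l => ⟨condProbR_nonneg _ _ _, condProbR_le_one _ _ _⟩))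
      (fun η => h2 (restrictPast η)) C

theorem IsCondG.integrable [IsFiniteMeasure ν] (hP : IsCondG ν b P) (a : Bool) :
    Integrable (fun η => P a (restrictPast η)) ν :=
  Integrable.of_bound ((hP.measurable a).comp measurable_restrictPast).aestronglyMeasurable 1
    (Eventually.of_forall fun η => by
      rw [Real.norm_of_nonneg (hP.mem_Icc a _).1]
      exact (hP.mem_Icc a _).2)

end Limits

theorem setIntegral_condG_of_isLocalEvent {β h : ℝ} (hβ : 0 < β) {μ : Measure Cfg2}
    (hμ : IsPlusPhase β h μ) {P : Bool → Past Bool → ℝ} (hP : IsCondG (schonmann μ) true P)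
    {C : Set (Past Bool)} (hC : IsLocalEvent C) :
    ∫ η in restrictPast ⁻¹' C, P true (restrictPast η) ∂schonmann μ =
      (schonmann μ).real ({η | η 0 = true} ∩ restrictPast ⁻¹' C) := by
  have := hμ.1
  have := isProbabilityMeasure_schonmann (μ := μ)
  set A : Set (ZSeq Bool) := {η | η 0 = true} with hA
  have hAloc : IsLocalEvent A := IsLocalEvent.of_coord 0 true
  have hAup : IsUpperSet A := fun a b hab ha => by
    have h1 := hab 0
    rw [show a 0 = true from ha] at h1
    exact top_le_iff.mp h1
  obtain ⟨F, hF⟩ := hP.tendsto_setIntegral true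
  have hle : ∫ η, P true (restrictPast η) ∂schonmann μ ≤ (schonmann μ).real A := by
    obtain ⟨h1, h2⟩ := hF Set.univ
    simp only [Measure.restrict_univ] at h1 h2
    exact le_of_tendsto_of_tendsto' h2 (tendsto_plusProb_schonmann hμ hAloc) fun n =>
      le_of_tendsto' (h1 n) fun l => integral_condProbR_pastEvt_le hβ hμ hAloc hAup n l
  have hge : ∀ D : Set (Past Bool), IsLocalEvent D →
      (schonmann μ).real (A ∩ restrictPast ⁻¹' D) ≤
        ∫ η in restrictPast ⁻¹' D, P true (restrictPast η) ∂schonmann μ := by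
    intro D hD
    obtain ⟨m, hm⟩ := hD.exists_recentPast_preimage
    obtain ⟨h1, h2⟩ := hF (restrictPast ⁻¹' D)
    refine ge_of_tendsto h2 ?_
    filter_upwards [eventually_ge_atTop m] with n hn
    refine ge_of_tendsto' (h1 n) fun l => ?_
    obtain ⟨T, hT⟩ := hm n hn
    rw [hT]
    exact schonmann_inter_le_setIntegral hβ hμ hAloc hAup n l T
  have hCm : MeasurableSet (restrictPast ⁻¹' C) := measurable_restrictPast hC.measurableSet
  have hcompl : IsLocalEvent Cᶜ := hC.imp fun S hS η η' hη => not_congr (hS η η' hη)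
  have h1 := hge C hC
  have h2 := hge Cᶜ hcompl
  have h3 := integral_add_compl hCm (hP.integrable true)
  have h4 := measureReal_inter_add_sdiff (μ := schonmann μ) (s := A) hCm
  rw [Set.preimage_compl] at h2
  rw [Set.sdiff_eq] at h4
  linarith

theorem setIntegral_condG {β h : ℝ} (hβ : 0 < β) {μ : Measure Cfg2}
    (hμ : IsPlusPhase β h μ) {P : Bool → Past Bool → ℝ} (hP : IsCondG (schonmann μ) true P)
    {C : Set (Past Bool)} (hC : MeasurableSet C) :
    ∫ η in restrictPast ⁻¹' C, P true (restrictPast η) ∂schonmann μ =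
      (schonmann μ).real ({η | η 0 = true} ∩ restrictPast ⁻¹' C) := by
  have := hμ.1
  have := isProbabilityMeasure_schonmann (μ := μ)
  set m₁ := ((schonmann μ).restrict {η | η 0 = true}).map restrictPast with hm₁
  set m₂ := ((schonmann μ).withDensity fun η => ENNReal.ofReal (P true (restrictPast η))).map
    restrictPast with hm₂
  have h1 : ∀ D : Set (Past Bool), MeasurableSet D →
      m₁ D = ENNReal.ofReal ((schonmann μ).real ({η | η 0 = true} ∩ restrictPast ⁻¹' D)) := by
    intro D hD
    rw [hm₁, Measure.map_apply measurable_restrictPast hD,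
      Measure.restrict_apply (measurable_restrictPast hD), Set.inter_comm, ofReal_measureReal]
  have h2 : ∀ D : Set (Past Bool), MeasurableSet D →
      m₂ D = ENNReal.ofReal
        (∫ η in restrictPast ⁻¹' D, P true (restrictPast η) ∂schonmann μ) := by
    intro D hD
    rw [hm₂, Measure.map_apply measurable_restrictPast hD,
      withDensity_apply _ (measurable_restrictPast hD),
      ofReal_integral_eq_lintegral_ofReal (hP.integrable true).integrableOn
        (Eventually.of_forall fun η => (hP.mem_Icc true _).1)]
  have h3 : m₁ = m₂ := measure_ext_of_allPlus fun S => by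
    have hD : IsLocalEvent {η : Past Bool | ∀ i ∈ S, η i = true} :=
      IsLocalEvent.of_cylinder S fun _ => true
    rw [h1 _ hD.measurableSet, h2 _ hD.measurableSet,
      setIntegral_condG_of_isLocalEvent hβ hμ hP hD]
  have h4 := h2 C hC
  rw [← h3, h1 C hC] at h4
  exact ((ENNReal.ofReal_eq_ofReal_iff measureReal_nonneg
    (integral_nonneg fun η => (hP.mem_Icc true _).1)).mp h4).symm

theorem IsCondG.false_eq {β h : ℝ} (hβ : 0 < β) {μ : Measure Cfg2} (hμ : IsPlusPhase β h μ)
    {P : Bool → Past Bool → ℝ} (hP : IsCondG (schonmann μ) true P) (ω : Past Bool) :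
    P false ω = 1 - P true ω := by
  have := hμ.1
  have := isProbabilityMeasure_schonmann (μ := μ)
  obtain ⟨L, h1, h2⟩ := hP true ω
  obtain ⟨L', h1', h2'⟩ := hP false ω
  have hsum : ∀ n l, condProbR (schonmann μ) {η | η 0 = false} (pastEvt n l true ω) =
      1 - condProbR (schonmann μ) {η | η 0 = true} (pastEvt n l true ω) := by
    intro n l
    have hpos := schonmann_pastEvt_pos hβ hμ n l true ω
    have : IsProbabilityMeasure ((schonmann μ)[|pastEvt n l true ω]) :=
      cond_isProbabilityMeasure fun h0 => by simp [Measure.real, h0] at hpos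
    have hc : {η : ZSeq Bool | η 0 = false} = {η : ZSeq Bool | η 0 = true}ᶜ := by
      ext η
      simp
    rw [hc]
    exact probReal_compl_eq_one_sub (IsLocalEvent.of_coord (0 : ℤ) true).measurableSet
  have h3 : ∀ n, L' n = 1 - L n := fun n => by
    refine tendsto_nhds_unique (h1' n) ?_
    simp only [hsum]
    exact (h1 n).const_sub 1
  refine tendsto_nhds_unique h2' ?_
  rw [funext h3]
  exact h2.const_sub 1

theorem condG_ae_eq_condExp {β h : ℝ} (hβ : 0 < β) {μ : Measure Cfg2} (hμ : IsPlusPhase β h μ)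
    {P : Bool → Past Bool → ℝ} (hP : IsCondG (schonmann μ) true P) (a : Bool) :
    (fun η => P a (restrictPast η)) =ᵐ[schonmann μ]
      (schonmann μ)[Set.indicator {η : ZSeq Bool | η 0 = a} (fun _ => (1 : ℝ)) | pastSigma Bool] := by
  have := hμ.1
  have := isProbabilityMeasure_schonmann (μ := μ)
  have hm : pastSigma Bool ≤ MeasurableSpace.pi := measurable_restrictPast.comap_le
  have hAm : ∀ a, MeasurableSet {η : ZSeq Bool | η 0 = a} := fun a =>
    (IsLocalEvent.of_coord 0 a).measurableSet
  refine ae_eq_condExp_of_forall_setIntegral_eq hm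
    ((integrable_const (1 : ℝ)).indicator (hAm a)) (fun s _ _ => (hP.integrable a).integrableOn) ?_
    ((hP.measurable a).comp (comap_measurable _)).aestronglyMeasurable
  rintro _ ⟨C, hC, rfl⟩ -
  have hC' : MeasurableSet (restrictPast ⁻¹' C) := measurable_restrictPast hC
  have htrue := setIntegral_condG hβ hμ hP hC
  rw [setIntegral_indicator (hAm a), setIntegral_const, smul_eq_mul, mul_one]
  cases a with
  | true =>
    rw [Set.inter_comm]
    exact htrue
  | false =>
    simp only [hP.false_eq hβ hμ]
    have hc : {η : ZSeq Bool | η 0 = false} = {η : ZSeq Bool | η 0 = true}ᶜ := by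
      ext η
      simp
    have h4 := measureReal_inter_add_sdiff (μ := schonmann μ) (s := restrictPast ⁻¹' C) (hAm true)
    rw [integral_sub (integrable_const 1) (hP.integrable true).integrableOn, htrue,
      setIntegral_const, smul_eq_mul, mul_one, hc, ← Set.sdiff_eq, Set.inter_comm]
    linarith

/-- For all `β > 0` and `h`, the Schonmann projection `ν_{β,h}^+` is a
g-measure consistent with `P_{β,h}^{+,+}`; equivalently `ν_{β,h}^+ = ν_{β,h}^{+,+}`. -/
theorem schonmann_consistent_with_plus_condG
    (β h : ℝ) (hβ : 0 < β) (μp : Measure Cfg2) (hμp : IsPlusPhase β h μp)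
    (Pp : Bool → Past Bool → ℝ) (hPp : IsCondG (schonmann μp) true Pp)
    (νp : Measure (ZSeq Bool)) (hνp : IsCondLimitMeasure (schonmann μp) true νp) :
    IsGMeasure (schonmann μp) Pp ∧ schonmann μp = νp := by
  have := hμp.1
  exact ⟨⟨isProbabilityMeasure_schonmann, map_shiftSeq_schonmann hβ hμp,
    condG_ae_eq_condExp hβ hμp hPp⟩, schonmann_eq_condLimit hβ hμp hνp⟩
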